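/- arXiv:2303.05467 — 3 statements merged into one kernel-verified Lean document; each statement's English description precedes it below -/
import Mathlib

section
/- Let c > -1 and define Q_c(y₀, r) = ∫_{y₀}^{y₀+r} y^c dy for y₀, r > 0. Then there exists a constant C ≥ 1 depending only on c such that Q_c satisfies the doubling condition Q_c(y₀, s)/Q_c(y₀, r) ≤ C (1 ∨ (s/r))^{1 ∨ (c+1)} for all y₀ > 0 and all s, r > 0. -/
open MeasureTheory Set Real

/-- `Q_c(y₀, r) = ∫_{y₀}^{y₀+r} y^c dy`. -/
noncomputable def Qc (c y₀ r : ℝ) : ℝ := ∫ y in y₀..(y₀ + r), y ^ c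

theorem rpow_add_mul_le {c y u l : ℝ} (hy : 0 < y) (hu : 0 ≤ u) (hl : 1 ≤ l) :
    l * (y + l * u) ^ c ≤ l ^ max 1 (c + 1) * (y + u) ^ c := by
  have hl0 : 0 < l := one_pos.trans_le hl
  have hyu : 0 < y + u := by positivity
  rcases le_total 0 c with h | h
  · rw [max_eq_right (by linarith), rpow_add hl0, rpow_one, mul_comm (l ^ c), mul_assoc,
      ← mul_rpow hl0.le hyu.le]
    gcongr
    nlinarith
  · rw [max_eq_left (by linarith), rpow_one]
    refine mul_le_mul_of_nonneg_left (rpow_le_rpow_of_nonpos hyu ?_ h) hl0.le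
    nlinarith

theorem intervalIntegrable_rpow_add_mul {c y l r : ℝ} (hy : 0 < y) (hl : 0 ≤ l) (hr : 0 ≤ r) :
    IntervalIntegrable (fun u => (y + l * u) ^ c) volume 0 r := by
  refine ContinuousOn.intervalIntegrable fun u hu => ?_
  rw [uIcc_of_le hr] at hu
  have h : y + l * u ≠ 0 := by nlinarith [mul_nonneg hl hu.1]
  exact ContinuousAt.continuousWithinAt (by fun_prop (disch := simp [h]))

theorem Qc_mul (c y l r : ℝ) : Qc c y (l * r) = ∫ u in (0 : ℝ)..r, l * (y + l * u) ^ c := by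
  rw [intervalIntegral.integral_const_mul,
    intervalIntegral.mul_integral_comp_add_mul (f := fun x => x ^ c)]
  simp [Qc]

theorem Qc_eq (c y r : ℝ) : Qc c y r = ∫ u in (0 : ℝ)..r, (y + u) ^ c := by
  simpa using Qc_mul c y 1 r

theorem intervalIntegrable_rpow_add {c y r : ℝ} (hy : 0 < y) (hr : 0 ≤ r) :
    IntervalIntegrable (fun u => (y + u) ^ c) volume 0 r := by
  simpa using intervalIntegrable_rpow_add_mul (c := c) hy zero_le_one hr

theorem Qc_pos {c y r : ℝ} (hy : 0 < y) (hr : 0 < r) : 0 < Qc c y r := by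
  rw [Qc_eq]
  refine intervalIntegral.intervalIntegral_pos_of_pos_on (intervalIntegrable_rpow_add hy hr.le)
    (fun u hu => ?_) hr
  have := hu.1
  positivity

theorem Qc_mono {c y s r : ℝ} (hy : 0 < y) (hs : 0 ≤ s) (h : s ≤ r) : Qc c y s ≤ Qc c y r := by
  rw [Qc_eq, Qc_eq]
  refine intervalIntegral.integral_mono_interval le_rfl hs h ?_
    (intervalIntegrable_rpow_add hy (hs.trans h))
  filter_upwards [ae_restrict_mem measurableSet_Ioc] with u hu
  have := hu.1
  simp only [Pi.zero_apply]
  positivity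

theorem Qc_mul_le {c y l r : ℝ} (hy : 0 < y) (hl : 1 ≤ l) (hr : 0 ≤ r) :
    Qc c y (l * r) ≤ l ^ max 1 (c + 1) * Qc c y r := by
  rw [Qc_mul, Qc_eq, ← intervalIntegral.integral_const_mul]
  exact intervalIntegral.integral_mono_on hr
    ((intervalIntegrable_rpow_add_mul hy (zero_le_one.trans hl) hr).const_mul l)
    ((intervalIntegrable_rpow_add hy hr).const_mul _)
    fun u hu => rpow_add_mul_le hy hu.1 hl

/-- for `c > -1` there is a constant `C ≥ 1` (depending only on `c`) such
that `Q_c` satisfies the doubling condition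
`Q_c(y₀,s)/Q_c(y₀,r) ≤ C (1 ∨ (s/r))^{1 ∨ (c+1)}` for all `y₀ > 0` and `s, r > 0`. -/
theorem statement_3 (c : ℝ) (hc : -1 < c) :
    ∃ C : ℝ, 1 ≤ C ∧
      ∀ y₀ s r : ℝ, 0 < y₀ → 0 < s → 0 < r →
        Qc c y₀ s / Qc c y₀ r ≤ C * (max 1 (s / r)) ^ (max 1 (c + 1)) := by
  refine ⟨1, le_rfl, fun y₀ s r hy hs hr => ?_⟩
  rw [one_mul, div_le_iff₀ (Qc_pos hy hr)]
  exact (Qc_mono hy hs.le ((div_le_iff₀ hr).mp (le_max_right 1 (s / r)))).trans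
    (Qc_mul_le hy (le_max_left _ _) hr.le)
end

section
/- Let c > -1 and b ∈ ℝ with |b| = 1, and define the operator L_b u = u'' + (c/y) u' + i b u' − (b²/4) u on (0,∞). Then there exists a constant C > 0, depending only on c, such that for every λ > 0 and every u ∈ Ĉ²_𝒩: λ ‖u‖_∞ + λ^{1/2} ‖u'‖_∞ + ‖u''‖_∞ ≤ C ( ‖λ u − L_b u‖_∞ + ‖u‖_∞ ). -/
open MeasureTheory Set Real Filter

/-- Supremum norm on `[0,∞)`. -/
noncomputable def supIci (f : ℝ → ℂ) : ℝ := ⨆ y : Ici (0:ℝ), ‖f y.1‖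

/-- Supremum norm on `(0,∞)`. -/
noncomputable def supIoi (f : ℝ → ℂ) : ℝ := ⨆ y : Ioi (0:ℝ), ‖f y.1‖

/-- Membership in `Ĉ²_𝒩`: `u, u', u''` are uniformly continuous on `[0,∞)`,
tend to `0` at infinity, `u'` and `u''` are the first and second derivatives of `u` on
`[0,∞)`, and `u'(0) = 0`. -/
def MemC2N (u u' u'' : ℝ → ℂ) : Prop :=
  (∀ y ∈ Ici (0:ℝ), HasDerivWithinAt u (u' y) (Ici 0) y)
  ∧ (∀ y ∈ Ici (0:ℝ), HasDerivWithinAt u' (u'' y) (Ici 0) y)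
  ∧ UniformContinuousOn u (Ici 0) ∧ UniformContinuousOn u' (Ici 0)
  ∧ UniformContinuousOn u'' (Ici 0)
  ∧ Tendsto u atTop (nhds 0) ∧ Tendsto u' atTop (nhds 0) ∧ Tendsto u'' atTop (nhds 0)
  ∧ u' 0 = 0

/-- `L_b u = u'' + (c/y)u' + i b u' − (b²/4) u`, expressed through `u'`, `u''`. -/
noncomputable def Lb (c b : ℝ) (u u' u'' : ℝ → ℂ) (y : ℝ) : ℂ :=
  u'' y + ((c : ℂ) / (y : ℂ)) * u' y + Complex.I * (b : ℂ) * u' y - ((b : ℂ) ^ 2 / 4) * u y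

/-- A function on `[0,∞)` which is continuous and vanishes at infinity attains its maximal modulus. -/
theorem exists_forall_norm_le_of_tendsto_zero {f : ℝ → ℂ} (hf : ContinuousOn f (Ici 0))
    (h0 : Tendsto f atTop (nhds 0)) :
    ∃ x ∈ Ici (0:ℝ), ∀ y ∈ Ici (0:ℝ), ‖f y‖ ≤ ‖f x‖ := by
  by_cases hz : ∃ z ∈ Ici (0:ℝ), f z ≠ 0
  · obtain ⟨z, hz0, hz⟩ := hz
    have hev : ∀ᶠ y in atTop, ‖f y‖ < ‖f z‖ := by
      have h := h0.norm
      rw [norm_zero] at h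
      exact h.eventually_lt_const (norm_pos_iff.mpr hz)
    obtain ⟨R, hR⟩ := eventually_atTop.mp hev
    have hzR : z ∈ Icc 0 (max R z) := ⟨hz0, le_max_right _ _⟩
    obtain ⟨x, hx, hmax⟩ := isCompact_Icc.exists_isMaxOn ⟨z, hzR⟩
      (hf.mono (fun y hy => hy.1 : Icc 0 (max R z) ⊆ Ici 0)).norm
    refine ⟨x, hx.1, fun y hy => ?_⟩
    rcases le_total y (max R z) with h | h
    · exact hmax ⟨hy, h⟩
    · exact (hR y ((le_max_left _ _).trans h)).le.trans (hmax hzR)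
  · push Not at hz
    exact ⟨0, self_mem_Ici, fun y hy => by rw [hz y hy, hz 0 self_mem_Ici]⟩

/-- Second-order necessary condition at a maximum, using only points to the right. -/
theorem nonpos_of_isMaxOn_Ici {v v' : ℝ → ℝ} {v'' x : ℝ}
    (hv : ∀ y ∈ Ici x, HasDerivWithinAt v (v' y) (Ici x) y)
    (hv' : HasDerivWithinAt v' v'' (Ici x) x) (hx : v' x = 0)
    (hmax : ∀ y ∈ Ici x, v y ≤ v x) : v'' ≤ 0 := by
  by_contra! hpos
  have hs := hasDerivWithinAt_iff_tendsto_slope.mp hv'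
  rw [Ici_sdiff_left] at hs
  have hev := hs.eventually_const_lt hpos
  obtain ⟨z, hz, hzs⟩ := mem_nhdsGT_iff_exists_Ioo_subset.mp hev
  have hz : x < z := hz
  set m := (x + z) / 2 with hm
  have hxm : x < m := by rw [hm]; linarith
  have hmz : m < z := by rw [hm]; linarith
  have hder : ∀ y ∈ Ioo x m, HasDerivAt v (v' y) y := fun y hy =>
    (hv y hy.1.le).hasDerivAt (Ici_mem_nhds hy.1)
  obtain ⟨ξ, hξ, h⟩ := exists_hasDerivAt_eq_slope v v' hxm
    (fun y hy => ((hv y hy.1).continuousWithinAt).mono Icc_subset_Ici_self) hder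
  have h1 : 0 < slope v' x ξ := hzs ⟨hξ.1, hξ.2.trans hmz⟩
  rw [slope_def_field, hx, sub_zero] at h1
  have h2 : 0 < v' ξ := by
    have := mul_pos h1 (sub_pos.mpr hξ.1)
    rwa [div_mul_cancel₀ _ (sub_pos.mpr hξ.1).ne'] at this
  have h3 : v' ξ ≤ 0 := by
    rw [h]
    exact div_nonpos_of_nonpos_of_nonneg (sub_nonpos.mpr (hmax m hxm.le)) (sub_pos.mpr hxm).le
  linarith

/-- The difference quotient of a function vanishing at `0` is right-continuous there. -/
theorem tendsto_div_of_hasDerivWithinAt {f : ℝ → ℂ} {f' : ℂ} (h0 : f 0 = 0)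
    (hf : HasDerivWithinAt f f' (Ici 0) 0) :
    Tendsto (fun y : ℝ => f y / y) (nhdsWithin 0 (Ioi 0)) (nhds f') := by
  have hs := hasDerivWithinAt_iff_tendsto_slope.mp hf
  rw [Ici_sdiff_left] at hs
  refine hs.congr fun y => ?_
  rw [slope_def_module, h0, sub_zero, sub_zero, Complex.real_smul, Complex.ofReal_inv,
    div_eq_inv_mul]

/-- Pairing with the value at a point of maximal modulus gives a real maximum. -/
theorem re_conj_mul_le_of_norm_le {a b : ℂ} (h : ‖b‖ ≤ ‖a‖) :
    (starRingEnd ℂ a * b).re ≤ (starRingEnd ℂ a * a).re := by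
  calc (starRingEnd ℂ a * b).re ≤ ‖starRingEnd ℂ a * b‖ := Complex.re_le_norm _
    _ = ‖a‖ * ‖b‖ := by rw [norm_mul, RCLike.norm_conj]
    _ ≤ ‖a‖ * ‖a‖ := by gcongr
    _ = (starRingEnd ℂ a * a).re := by
      rw [← Complex.normSq_eq_conj_mul_self, Complex.ofReal_re, Complex.normSq_eq_norm_sq, sq]

/-- Composition of a derivative with the real part of a fixed complex multiple. -/
theorem HasDerivWithinAt.re_const_mul {f : ℝ → ℂ} {f' : ℂ} {s : Set ℝ} {x : ℝ}
    (hf : HasDerivWithinAt f f' s x) (a : ℂ) :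
    HasDerivWithinAt (fun y => (a * f y).re) (a * f').re s x :=
  Complex.reCLM.hasFDerivAt.comp_hasDerivWithinAt x (hf.const_mul a)

/-- If `k ‖a‖² ≤ Re (conj a * h)` and `‖h‖ ≤ H` then `k ‖a‖ ≤ H`. -/
theorem mul_norm_le_of_mul_re_le {a h : ℂ} {k H : ℝ} (hH : ‖h‖ ≤ H)
    (hk : k * (starRingEnd ℂ a * a).re ≤ (starRingEnd ℂ a * h).re) : k * ‖a‖ ≤ H := by
  rcases eq_or_ne a 0 with rfl | ha
  · simpa using (norm_nonneg h).trans hH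
  have hpos : 0 < ‖a‖ := norm_pos_iff.mpr ha
  have h1 : (starRingEnd ℂ a * h).re ≤ ‖a‖ * H := by
    calc (starRingEnd ℂ a * h).re ≤ ‖starRingEnd ℂ a * h‖ := Complex.re_le_norm _
      _ = ‖a‖ * ‖h‖ := by rw [norm_mul, RCLike.norm_conj]
      _ ≤ ‖a‖ * H := by gcongr
  rw [← Complex.normSq_eq_conj_mul_self, Complex.ofReal_re, Complex.normSq_eq_norm_sq] at hk
  refine le_of_mul_le_mul_left ?_ hpos
  linarith [show ‖a‖ * (k * ‖a‖) = k * ‖a‖ ^ 2 by ring]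

/-- Landau-type interpolation of the first derivative on `[0,∞)`. -/
theorem norm_deriv_le_interpolation {u u' u'' : ℝ → ℂ} {A B t y : ℝ}
    (hu : ∀ y ∈ Ici (0:ℝ), HasDerivWithinAt u (u' y) (Ici 0) y)
    (hu' : ∀ y ∈ Ici (0:ℝ), HasDerivWithinAt u' (u'' y) (Ici 0) y)
    (hA : ∀ y ∈ Ici (0:ℝ), ‖u y‖ ≤ A) (hB : ∀ y ∈ Ici (0:ℝ), ‖u'' y‖ ≤ B)
    (ht : 0 < t) (hy : 0 ≤ y) : t * ‖u' y‖ ≤ 2 * A + t ^ 2 * B := by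
  have hsub : Icc y (y + t) ⊆ Ici (0:ℝ) := fun z hz => hy.trans hz.1
  have hB0 : 0 ≤ B := (norm_nonneg _).trans (hB 0 self_mem_Ici)
  have hyI : y ∈ Icc y (y + t) := ⟨le_rfl, by linarith⟩
  have htI : y + t ∈ Icc y (y + t) := ⟨by linarith, le_rfl⟩
  have hd : ∀ s ∈ Icc y (y + t), HasDerivWithinAt (fun s : ℝ => u s - (s:ℂ) * u' y)
      (u' s - u' y) (Icc y (y + t)) s := fun s hs => by
    have h1 := (hu s (hsub hs)).mono hsub
    have h2 := (Complex.ofRealCLM.hasDerivWithinAt (s := Icc y (y + t)) (x := s)).mul_const (u' y)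
    simpa using h1.fun_sub h2
  have hb : ∀ s ∈ Icc y (y + t), ‖u' s - u' y‖ ≤ B * t := fun s hs => by
    have h := (convex_Ici (0:ℝ)).norm_image_sub_le_of_norm_hasDerivWithin_le hu' hB
      (hsub hyI) (hsub hs)
    refine h.trans ?_
    rw [Real.norm_of_nonneg (by linarith [hs.1])]
    gcongr
    linarith [hs.2]
  have h := (convex_Icc y (y + t)).norm_image_sub_le_of_norm_hasDerivWithin_le hd hb hyI htI
  rw [show y + t - y = t by ring, Real.norm_of_nonneg ht.le] at h
  have h3 : (t:ℂ) * u' y = u (y + t) - u y -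
      (u (y + t) - ((y + t : ℝ) : ℂ) * u' y - (u y - (y:ℂ) * u' y)) := by
    push_cast; ring
  have h4 : t * ‖u' y‖ = ‖(t:ℂ) * u' y‖ := by
    rw [norm_mul, Complex.norm_of_nonneg ht.le]
  rw [h4, h3]
  have h5 := norm_sub_le (u (y + t) - u y)
      (u (y + t) - ((y + t : ℝ) : ℂ) * u' y - (u y - (y:ℂ) * u' y))
  have h6 := norm_sub_le (u (y + t)) (u y)
  have h7 := hA _ (hsub hyI)
  have h8 := hA _ (hsub htI)
  nlinarith

/-- The continuous extension of `v / y` to `[0,∞)` attains its maximal modulus. -/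
theorem exists_max_div {v v' : ℝ → ℂ}
    (hv : ∀ y ∈ Ici (0:ℝ), HasDerivWithinAt v (v' y) (Ici 0) y)
    (hlim : Tendsto v atTop (nhds 0)) (h0 : v 0 = 0) :
    ∃ x ∈ Ici (0:ℝ), ∀ y ∈ Ici (0:ℝ),
      ‖Function.update (fun y : ℝ => v y / y) 0 (v' 0) y‖
        ≤ ‖Function.update (fun y : ℝ => v y / y) 0 (v' 0) x‖ := by
  apply exists_forall_norm_le_of_tendsto_zero
  · intro y hy
    rcases eq_or_lt_of_le (mem_Ici.mp hy) with rfl | hpos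
    · rw [continuousWithinAt_update_same, Ici_sdiff_left]
      exact tendsto_div_of_hasDerivWithinAt h0 (hv 0 self_mem_Ici)
    · rw [continuousWithinAt_update_of_ne hpos.ne']
      exact (hv y hy).continuousWithinAt.div Complex.continuous_ofReal.continuousWithinAt
        (Complex.ofReal_ne_zero.mpr hpos.ne')
  · have h1 : Tendsto (fun y : ℝ => v y / y) atTop (nhds 0) := by
      have h2 : Tendsto (fun y : ℝ => ((y⁻¹ : ℝ) : ℂ)) atTop (nhds 0) := by
        have h3 := Complex.continuous_ofReal.tendsto 0
        rw [Complex.ofReal_zero] at h3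
        exact h3.comp tendsto_inv_atTop_zero
      simpa [div_eq_mul_inv] using hlim.mul h2
    refine h1.congr' ?_
    filter_upwards [eventually_gt_atTop 0] with y hy
    rw [Function.update_of_ne (ne_of_gt hy)]

/-- Maximum principle for `w = v / y`: from `v' + (c/y) v = (1 + c) w + y w'` one controls `w`. -/
theorem norm_div_le_of_norm_add_le {c G : ℝ} {v v' : ℝ → ℂ}
    (hv : ∀ y ∈ Ici (0:ℝ), HasDerivWithinAt v (v' y) (Ici 0) y)
    (hcont : ContinuousOn v' (Ici 0))
    (hlim : Tendsto v atTop (nhds 0)) (h0 : v 0 = 0) (hc : -1 < c)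
    (hG : ∀ y ∈ Ioi (0:ℝ), ‖v' y + (c:ℂ) / y * v y‖ ≤ G) :
    ∀ y ∈ Ioi (0:ℝ), (1 + c) * ‖v y / y‖ ≤ G := by
  obtain ⟨x, hx, hmax⟩ := exists_max_div hv hlim h0
  set w := Function.update (fun y : ℝ => v y / y) 0 (v' 0) with hw
  have hwpos : ∀ y : ℝ, 0 < y → w y = v y / y := fun y hy => by
    rw [hw, Function.update_of_ne hy.ne']
  suffices hkey : (1 + c) * ‖w x‖ ≤ G by
    intro y hy
    rw [← hwpos y hy]
    exact (mul_le_mul_of_nonneg_left (hmax y (mem_Ici.mpr (le_of_lt hy))) (by linarith)).trans hkey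
  rcases eq_or_lt_of_le (mem_Ici.mp hx) with rfl | hpos
  · have ht : Tendsto (fun y : ℝ => v' y + (c:ℂ) / y * v y) (nhdsWithin 0 (Ioi 0))
        (nhds (v' 0 + c * v' 0)) := by
      have h1 : Tendsto v' (nhdsWithin 0 (Ioi 0)) (nhds (v' 0)) :=
        (hcont 0 self_mem_Ici).mono_left (nhdsWithin_mono _ Ioi_subset_Ici_self)
      refine (h1.add ((tendsto_div_of_hasDerivWithinAt h0 (hv 0 self_mem_Ici)).const_mul
        (c:ℂ))).congr fun y => ?_
      ring
    have hle := le_of_tendsto ht.norm (eventually_nhdsWithin_of_forall hG)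
    have hw0 : w 0 = v' 0 := by rw [hw, Function.update_self]
    rw [show v' 0 + c * v' 0 = ((1 + c : ℝ) : ℂ) * v' 0 by push_cast; ring, norm_mul,
      Complex.norm_of_nonneg (by linarith)] at hle
    rwa [hw0]
  · have hxC : (x:ℂ) ≠ 0 := Complex.ofReal_ne_zero.mpr hpos.ne'
    have hwd : HasDerivAt (fun y : ℝ => v y / y) ((v' x * x - v x * 1) / (x:ℂ) ^ 2) x :=
      ((hv x hx).hasDerivAt (Ici_mem_nhds hpos)).div Complex.ofRealCLM.hasDerivAt hxC
    have hr := (hwd.hasDerivWithinAt (s := univ)).re_const_mul (starRingEnd ℂ (w x))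
    rw [hasDerivWithinAt_univ] at hr
    have hloc : IsLocalMax (fun y : ℝ => (starRingEnd ℂ (w x) * (v y / y)).re) x := by
      filter_upwards [Ioi_mem_nhds hpos] with y hy
      rw [← hwpos y hy, ← hwpos x hpos]
      exact re_conj_mul_le_of_norm_le (hmax y (mem_Ici.mpr (le_of_lt hy)))
    have hz := hloc.hasDerivAt_eq_zero hr
    refine mul_norm_le_of_mul_re_le (hG x hpos) ?_
    have hid : starRingEnd ℂ (w x) * (v' x + (c:ℂ) / x * v x)
        = ((1 + c : ℝ) : ℂ) * (starRingEnd ℂ (w x) * w x)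
          + (x:ℂ) * (starRingEnd ℂ (w x) * ((v' x * x - v x * 1) / (x:ℂ) ^ 2)) := by
      generalize starRingEnd ℂ (w x) = a
      rw [hwpos x hpos]
      push_cast
      field_simp
      ring
    rw [hid, Complex.add_re, Complex.re_ofReal_mul, Complex.re_ofReal_mul, hz]
    simp

/-- Dissipativity of the one-dimensional Bessel operator with Neumann boundary condition. -/
theorem mul_norm_le_of_norm_sub_bessel_le {c l H : ℝ} {u u' u'' : ℝ → ℂ}
    (hu : ∀ y ∈ Ici (0:ℝ), HasDerivWithinAt u (u' y) (Ici 0) y)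
    (hu' : ∀ y ∈ Ici (0:ℝ), HasDerivWithinAt u' (u'' y) (Ici 0) y)
    (hcont : ContinuousOn u'' (Ici 0))
    (hlim : Tendsto u atTop (nhds 0)) (h0 : u' 0 = 0) (hc : -1 < c) (hl : 0 ≤ l)
    (hH : ∀ y ∈ Ioi (0:ℝ), ‖(l:ℂ) * u y - (u'' y + (c:ℂ) / y * u' y)‖ ≤ H) :
    ∀ y ∈ Ici (0:ℝ), l * ‖u y‖ ≤ H := by
  obtain ⟨x, hx, hmax⟩ := exists_forall_norm_le_of_tendsto_zero
    (fun y hy => (hu y hy).continuousWithinAt) hlim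
  suffices hkey : l * ‖u x‖ ≤ H from fun y hy =>
    (mul_le_mul_of_nonneg_left (hmax y hy) hl).trans hkey
  have hsub : Ici x ⊆ Ici (0:ℝ) := Ici_subset_Ici.mpr hx
  have hz : (starRingEnd ℂ (u x) * u' x).re = 0 := by
    rcases eq_or_lt_of_le (mem_Ici.mp hx) with h | hpos
    · rw [← h, h0]; simp
    · have hr := ((hu x hx).re_const_mul (starRingEnd ℂ (u x))).hasDerivAt (Ici_mem_nhds hpos)
      refine IsLocalMax.hasDerivAt_eq_zero ?_ hr
      filter_upwards [Ici_mem_nhds hpos] with y hy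
      exact re_conj_mul_le_of_norm_le (hmax y hy)
  have h2 : (starRingEnd ℂ (u x) * u'' x).re ≤ 0 :=
    nonpos_of_isMaxOn_Ici
      (fun y hy => ((hu y (hsub hy)).mono hsub).re_const_mul (starRingEnd ℂ (u x)))
      (((hu' x hx).mono hsub).re_const_mul (starRingEnd ℂ (u x))) hz
      (fun y hy => re_conj_mul_le_of_norm_le (hmax y (hsub hy)))
  rcases eq_or_lt_of_le (mem_Ici.mp hx) with rfl | hpos
  · have ht : Tendsto (fun y : ℝ => (l:ℂ) * u y - (u'' y + (c:ℂ) / y * u' y))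
        (nhdsWithin 0 (Ioi 0)) (nhds ((l:ℂ) * u 0 - (u'' 0 + c * u'' 0))) := by
      have hle : nhdsWithin (0:ℝ) (Ioi 0) ≤ nhdsWithin 0 (Ici 0) :=
        nhdsWithin_mono _ Ioi_subset_Ici_self
      have h1 : Tendsto u'' (nhdsWithin 0 (Ioi 0)) (nhds (u'' 0)) :=
        (hcont 0 self_mem_Ici).mono_left hle
      have h3 : Tendsto u (nhdsWithin 0 (Ioi 0)) (nhds (u 0)) :=
        (hu 0 self_mem_Ici).continuousWithinAt.mono_left hle
      refine ((h3.const_mul (l:ℂ)).sub (h1.add ((tendsto_div_of_hasDerivWithinAt h0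
        (hu' 0 self_mem_Ici)).const_mul (c:ℂ)))).congr fun y => ?_
      ring
    refine mul_norm_le_of_mul_re_le
      (le_of_tendsto ht.norm (eventually_nhdsWithin_of_forall hH)) ?_
    have hid : starRingEnd ℂ (u 0) * ((l:ℂ) * u 0 - (u'' 0 + c * u'' 0))
        = (l:ℂ) * (starRingEnd ℂ (u 0) * u 0)
          - ((1 + c : ℝ) : ℂ) * (starRingEnd ℂ (u 0) * u'' 0) := by
      push_cast; ring
    rw [hid, Complex.sub_re, Complex.re_ofReal_mul, Complex.re_ofReal_mul]
    nlinarith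
  · refine mul_norm_le_of_mul_re_le (hH x hpos) ?_
    have hid : starRingEnd ℂ (u x) * ((l:ℂ) * u x - (u'' x + (c:ℂ) / x * u' x))
        = (l:ℂ) * (starRingEnd ℂ (u x) * u x) - (starRingEnd ℂ (u x) * u'' x)
          - ((c / x : ℝ) : ℂ) * (starRingEnd ℂ (u x) * u' x) := by
      push_cast; ring
    rw [hid, Complex.sub_re, Complex.sub_re, Complex.re_ofReal_mul, Complex.re_ofReal_mul, hz]
    linarith

theorem norm_le_supIci {f : ℝ → ℂ} (hf : ContinuousOn f (Ici 0))
    (h0 : Tendsto f atTop (nhds 0)) : ∀ y ∈ Ici (0:ℝ), ‖f y‖ ≤ supIci f := by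
  obtain ⟨x, -, hmax⟩ := exists_forall_norm_le_of_tendsto_zero hf h0
  intro y hy
  exact le_ciSup (f := fun y : Ici (0:ℝ) => ‖f y.1‖)
    ⟨‖f x‖, by rintro _ ⟨z, rfl⟩; exact hmax z.1 z.2⟩ ⟨y, hy⟩

theorem supIci_le {f : ℝ → ℂ} {M : ℝ} (h : ∀ y ∈ Ici (0:ℝ), ‖f y‖ ≤ M) : supIci f ≤ M :=
  haveI : Nonempty (Ici (0:ℝ)) := ⟨⟨0, self_mem_Ici⟩⟩
  ciSup_le fun y => h y.1 y.2

theorem norm_le_supIoi {f : ℝ → ℂ} {M : ℝ} (h : ∀ y ∈ Ioi (0:ℝ), ‖f y‖ ≤ M) :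
    ∀ y ∈ Ioi (0:ℝ), ‖f y‖ ≤ supIoi f := fun y hy =>
  le_ciSup (f := fun y : Ioi (0:ℝ) => ‖f y.1‖)
    ⟨M, by rintro _ ⟨z, rfl⟩; exact h z.1 z.2⟩ ⟨y, hy⟩

/-- for `c > -1` there is `C > 0`, depending only on `c`, such that for
every `b` with `|b| = 1`, every `λ > 0` and every `u ∈ Ĉ²_𝒩`:
`λ‖u‖_∞ + λ^{1/2}‖u'‖_∞ + ‖u''‖_∞ ≤ C(‖λu − L_b u‖_∞ + ‖u‖_∞)`. -/
theorem statement_8 (c : ℝ) (hc : -1 < c) :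
    ∃ C : ℝ, 0 < C ∧
      ∀ b : ℝ, |b| = 1 →
      ∀ u u' u'' : ℝ → ℂ, MemC2N u u' u'' →
      ∀ l : ℝ, 0 < l →
        l * supIci u + Real.sqrt l * supIci u' + supIci u''
          ≤ C * (supIoi (fun y => (l : ℂ) * u y - Lb c b u u' u'' y) + supIci u) := by
  have hc1 : 0 < 1 + c := by linarith
  set K : ℝ := 2 * (1 + |c| / (1 + c)) with hK
  have hKpos : 0 < K := by positivity
  refine ⟨(3 + 2 * K) * (8 * K + 2), by positivity, ?_⟩
  rintro b hb u u' u'' ⟨hu, hu', -, -, hu''c, hl0, hl1, hl2, h0⟩ l hl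
  have hcont : ContinuousOn u'' (Ici 0) := hu''c.continuousOn
  have hM0 := norm_le_supIci (fun y hy => (hu y hy).continuousWithinAt) hl0
  have hM1 := norm_le_supIci (fun y hy => (hu' y hy).continuousWithinAt) hl1
  have hM2 := norm_le_supIci hcont hl2
  set M0 := supIci u
  set M1 := supIci u'
  set M2 := supIci u''
  have hM0n : 0 ≤ M0 := (norm_nonneg _).trans (hM0 0 self_mem_Ici)
  have hb2 : (b:ℂ) ^ 2 = 1 := by
    rw [← Complex.ofReal_pow, ← sq_abs, hb]; simp
  have hbn : ‖(b:ℂ)‖ = 1 := by rw [Complex.norm_real, Real.norm_eq_abs, hb]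
  have hlow : ∀ y ∈ Ici (0:ℝ),
      ‖Complex.I * (b:ℂ) * u' y - ((b:ℂ) ^ 2 / 4) * u y‖ ≤ M1 + M0 / 4 := fun y hy => by
    refine (norm_sub_le _ _).trans ?_
    rw [hb2, norm_mul, norm_mul, norm_mul, Complex.norm_I, hbn]
    have h4 : ‖(1 / 4 : ℂ)‖ = 1 / 4 := by norm_num
    rw [h4]
    linarith [hM1 y hy, hM0 y hy]
  have hbdd : ∃ M, ∀ y ∈ Ioi (0:ℝ), ‖(l:ℂ) * u y - Lb c b u u' u'' y‖ ≤ M := by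
    obtain ⟨x, -, hmax⟩ := exists_max_div hu' hl1 h0
    refine ⟨l * M0 + (M2 + |c| * ‖Function.update (fun y : ℝ => u' y / y) 0 (u'' 0) x‖
      + (M1 + M0 / 4)), fun y hy => ?_⟩
    have hy' : y ∈ Ici (0:ℝ) := mem_Ici.mpr (le_of_lt hy)
    have hw := hmax y hy'
    rw [Function.update_of_ne (ne_of_gt hy)] at hw
    have hsplit : Lb c b u u' u'' y = u'' y + (c:ℂ) * (u' y / y)
        + (Complex.I * (b:ℂ) * u' y - ((b:ℂ) ^ 2 / 4) * u y) := by
      unfold Lb; ring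
    rw [hsplit]
    refine (norm_sub_le _ _).trans (add_le_add ?_ ((norm_add_le _ _).trans
      (add_le_add ((norm_add_le _ _).trans (add_le_add (hM2 y hy') ?_)) (hlow y hy'))))
    · rw [norm_mul, Complex.norm_of_nonneg hl.le]
      exact mul_le_mul_of_nonneg_left (hM0 y hy') hl.le
    · rw [norm_mul, Complex.norm_real, Real.norm_eq_abs]
      exact mul_le_mul_of_nonneg_left hw (abs_nonneg c)
  obtain ⟨M, hM⟩ := hbdd
  have hF := norm_le_supIoi hM
  set F := supIoi (fun y => (l : ℂ) * u y - Lb c b u u' u'' y)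
  have hFn : 0 ≤ F := (norm_nonneg _).trans (hF 1 (mem_Ioi.mpr one_pos))
  obtain ⟨H, hHdef⟩ : ∃ H, H = F + (M1 + M0 / 4) := ⟨_, rfl⟩
  have hH : ∀ y ∈ Ioi (0:ℝ), ‖(l:ℂ) * u y - (u'' y + (c:ℂ) / y * u' y)‖ ≤ H := fun y hy => by
    have hsplit : (l:ℂ) * u y - (u'' y + (c:ℂ) / y * u' y) = ((l:ℂ) * u y - Lb c b u u' u'' y)
        + (Complex.I * (b:ℂ) * u' y - ((b:ℂ) ^ 2 / 4) * u y) := by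
      unfold Lb; ring
    rw [hsplit, hHdef]
    exact (norm_add_le _ _).trans (add_le_add (hF y hy) (hlow y (mem_Ici.mpr (le_of_lt hy))))
  have hdiss := mul_norm_le_of_norm_sub_bessel_le hu hu' hcont hl0 h0 hc hl.le hH
  have hG : ∀ y ∈ Ioi (0:ℝ), ‖u'' y + (c:ℂ) / y * u' y‖ ≤ 2 * H := fun y hy => by
    have h1 := norm_sub_le ((l:ℂ) * u y) ((l:ℂ) * u y - (u'' y + (c:ℂ) / y * u' y))
    rw [sub_sub_cancel, norm_mul, Complex.norm_of_nonneg hl.le] at h1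
    linarith [hH y hy, hdiss y (mem_Ici.mpr (le_of_lt hy))]
  have hw := norm_div_le_of_norm_add_le hu' hcont hl1 h0 hc hG
  have hpos2 : ∀ y ∈ Ioi (0:ℝ), ‖u'' y‖ ≤ K * H := fun y hy => by
    have h1 := norm_sub_le (u'' y + (c:ℂ) / y * u' y) ((c:ℂ) * (u' y / y))
    rw [show u'' y + (c:ℂ) / y * u' y - (c:ℂ) * (u' y / y) = u'' y by ring, norm_mul,
      Complex.norm_real, Real.norm_eq_abs] at h1
    have h2 : ‖u' y / y‖ ≤ 2 * H / (1 + c) := by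
      rw [le_div_iff₀' hc1]; exact hw y hy
    have h3 := mul_le_mul_of_nonneg_left h2 (abs_nonneg c)
    have h4 : K * H = 2 * H + |c| * (2 * H / (1 + c)) := by rw [hK]; ring
    linarith [hG y hy]
  have hM2' : M2 ≤ K * H := supIci_le fun y hy => by
    rcases eq_or_lt_of_le (mem_Ici.mp hy) with rfl | hpos
    · have ht : Tendsto u'' (nhdsWithin 0 (Ioi 0)) (nhds (u'' 0)) :=
        (hcont 0 self_mem_Ici).mono_left (nhdsWithin_mono _ Ioi_subset_Ici_self)
      exact le_of_tendsto ht.norm (eventually_nhdsWithin_of_forall hpos2)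
    · exact hpos2 y hpos
  have hM0' : l * M0 ≤ H := by
    rw [← le_div_iff₀' hl]
    exact supIci_le fun y hy => by rw [le_div_iff₀' hl]; exact hdiss y hy
  have hinterp : ∀ t : ℝ, 0 < t → t * M1 ≤ 2 * M0 + t ^ 2 * M2 := fun t ht => by
    rw [← le_div_iff₀' ht]
    refine supIci_le fun y hy => ?_
    rw [le_div_iff₀' ht]
    exact norm_deriv_le_interpolation hu hu' hM0 hM2 ht hy
  have hM1' : M1 ≤ 4 * K * M0 + H / 2 := by
    have h1 := hinterp (1 / (2 * K)) (by positivity)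
    have h2 : (1 / (2 * K)) ^ 2 * M2 ≤ (1 / (2 * K)) ^ 2 * (K * H) := by gcongr
    have h3 := mul_le_mul_of_nonneg_left (h1.trans (add_le_add_right h2 (2 * M0)))
      (by positivity : 0 ≤ 2 * K)
    have h4 : 2 * K * (1 / (2 * K) * M1) = M1 := by field_simp
    have h5 : 2 * K * (2 * M0 + (1 / (2 * K)) ^ 2 * (K * H)) = 4 * K * M0 + H / 2 := by
      field_simp; ring
    linarith
  have hHle : H ≤ (8 * K + 2) * (F + M0) := by
    nlinarith [mul_nonneg hKpos.le hFn]
  have hsqrt : Real.sqrt l * M1 ≤ 2 * (l * M0) + M2 := by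
    have hs : 0 < Real.sqrt l := Real.sqrt_pos.mpr hl
    have h1 := mul_le_mul_of_nonneg_left (hinterp (1 / Real.sqrt l) (by positivity)) hl.le
    have h2 : l * (1 / Real.sqrt l * M1) = Real.sqrt l * M1 := by
      nth_rewrite 1 [← Real.mul_self_sqrt hl.le]
      field_simp
    have h3 : l * (2 * M0 + (1 / Real.sqrt l) ^ 2 * M2) = 2 * (l * M0) + M2 := by
      rw [div_pow, Real.sq_sqrt hl.le]
      field_simp
    linarith
  calc l * M0 + Real.sqrt l * M1 + M2 ≤ (3 + 2 * K) * H := by linarith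
    _ ≤ (3 + 2 * K) * ((8 * K + 2) * (F + M0)) := by gcongr
    _ = (3 + 2 * K) * (8 * K + 2) * (F + M0) := by ring
end

section
/- Let c > -1 and b ∈ ℝ with |b| = 1, and define L_b u = u'' + (c/y) u' + i b u' − (b²/4) u on (0,∞). Then there exists a constant C > 0, depending only on c, such that for every u ∈ Ĉ²_𝒩, every λ > 0, every y > 0 and every r > 0: λ^{1/2} ‖u'‖_{L^∞(B⁺(y,r))} ≤ C ( ‖λ u − L_b u‖_{L^∞(B⁺(y,2r))} + (1/r² + 1) ‖u‖_{L^∞(B⁺(y,2r))} ), where B⁺(y,r) = B(y,r) ∩ (0,∞). -/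
open MeasureTheory Set Real Filter

/-- Supremum of `‖f‖` over a set. -/
noncomputable def supOn (f : ℝ → ℂ) (s : Set ℝ) : ℝ := ⨆ z : s, ‖f z.1‖

/-- `B⁺(y,r) = B(y,r) ∩ (0,∞)`. -/
def Bplus (y r : ℝ) : Set ℝ := Ioo (y - r) (y + r) ∩ Ioi 0

/-- One-sided second derivative test at a maximum. -/
lemma second_deriv_nonpos_of_right_max {g g' : ℝ → ℝ} {γ s e : ℝ} (he : s < e)
    (hg : ∀ t ∈ Ico s e, HasDerivWithinAt g (g' t) (Ici s) t)
    (hmax : ∀ t ∈ Ico s e, g t ≤ g s) (h₁ : g' s = 0)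
    (h₂ : HasDerivWithinAt g' γ (Ici s) s) : γ ≤ 0 := by
  by_contra! hγ
  have hpos : ∀ᶠ t in nhdsWithin s (Ioi s), 0 < g' t := by
    have := (hasDerivWithinAt_iff_tendsto_slope' (by simp)).1 (h₂.Ioi_of_Ici)
    filter_upwards [this.eventually (lt_mem_nhds hγ), self_mem_nhdsWithin] with t ht hst
    rw [slope_def_field, h₁, sub_zero] at ht
    exact (div_pos_iff_of_pos_right (sub_pos.2 hst)).1 ht
  obtain ⟨e', he', hsub⟩ := (mem_nhdsGT_iff_exists_Ioo_subset).1
    (hpos.and (Ioo_mem_nhdsGT he))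
  have hse' : s < e' := he'
  set m := (s + e') / 2 with hm
  have hsm : s < m := by linarith
  have hme : m < e' := by linarith
  have hlt : g s < g m := by
    refine strictMonoOn_of_deriv_pos (convex_Icc s m) ?_ ?_ (left_mem_Icc.2 hsm.le)
      (right_mem_Icc.2 hsm.le) hsm
    · intro t ht
      have htI : t ∈ Ico s e := by
        refine ⟨ht.1, ?_⟩
        exact ht.2.trans_lt (hsub ⟨hsm, hme⟩).2.2
      exact ((hg t htI).continuousWithinAt).mono Icc_subset_Ici_self
    · intro t ht
      rw [interior_Icc] at ht
      have h := hsub ⟨ht.1, ht.2.trans hme⟩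
      have hd := (hg t ⟨ht.1.le, h.2.2⟩).hasDerivAt (Ici_mem_nhds ht.1)
      rw [hd.deriv]
      exact h.1
  exact absurd (hmax m ⟨hsm.le, (hsub ⟨hsm, hme⟩).2.2⟩) (not_le.2 hlt)

lemma tendsto_div_self_of_hasDerivWithinAt_zero {w : ℝ → ℂ} {d : ℂ} (h0 : w 0 = 0)
    (h : HasDerivWithinAt w d (Ici 0) 0) :
    Tendsto (fun t : ℝ => w t / (t : ℂ)) (nhdsWithin 0 (Ioi 0)) (nhds d) := by
  have := (hasDerivWithinAt_iff_tendsto_slope' (by simp)).1 (h.Ioi_of_Ici)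
  refine this.congr fun t => ?_
  rw [slope_def_module, h0, sub_zero, sub_zero, Complex.real_smul, Complex.ofReal_inv]
  ring

/-- The limit at `0` of `L_b u`. -/
lemma tendsto_Lb_zero {c b : ℝ} {u u' u'' : ℝ → ℂ}
    (h₁ : HasDerivWithinAt u (u' 0) (Ici 0) 0)
    (h₂ : HasDerivWithinAt u' (u'' 0) (Ici 0) 0) (h₀ : u' 0 = 0)
    (h₃ : ContinuousWithinAt u'' (Ici 0) 0) :
    Tendsto (Lb c b u u' u'') (nhdsWithin 0 (Ioi 0))
      (nhds ((1 + c) * u'' 0 - (b : ℂ) ^ 2 / 4 * u 0)) := by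
  have m : nhdsWithin (0 : ℝ) (Ioi 0) ≤ nhdsWithin 0 (Ici 0) := nhdsWithin_mono _ Ioi_subset_Ici_self
  have t1 : Tendsto u _ _ := h₁.continuousWithinAt.mono_left m
  have t2 : Tendsto u' _ _ := h₂.continuousWithinAt.mono_left m
  have t3 : Tendsto u'' _ _ := Filter.Tendsto.mono_left h₃ m
  have t4 := tendsto_div_self_of_hasDerivWithinAt_zero h₀ h₂
  have := ((t3.add (t4.const_mul (c : ℂ))).add (t2.const_mul (Complex.I * b))).sub
    (t1.const_mul ((b : ℂ) ^ 2 / 4))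
  rw [h₀] at this
  refine Tendsto.congr (fun t => ?_) (this.trans (le_of_eq ?_))
  · simp only [Lb]; ring
  · congr 1; ring

/-- Derivative of the gauge transform `e^{ib(t-s)/2} w(t)`. -/
lemma HasDerivWithinAt.gauge {w : ℝ → ℂ} {d : ℂ} {S : Set ℝ} {t : ℝ}
    (h : HasDerivWithinAt w d S t) (b s : ℝ) (θ : ℂ) :
    HasDerivWithinAt (fun t : ℝ => (θ * Complex.exp (Complex.I * b / 2 * (t - s)) * w t).re)
      (θ * Complex.exp (Complex.I * b / 2 * (t - s)) * (d + Complex.I * b / 2 * w t)).re S t := by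
  have h1 : HasDerivAt (fun t : ℝ => Complex.I * b / 2 * ((t : ℂ) - s)) (Complex.I * b / 2) t := by
    simpa using ((Complex.ofRealCLM.hasDerivAt (x := t)).sub_const (s : ℂ)).const_mul
      (Complex.I * b / 2)
  have h2 := ((h1.cexp.const_mul θ).hasDerivWithinAt (s := S)).mul h
  have h3 := Complex.reCLM.hasFDerivAt.comp_hasDerivWithinAt t h2
  refine HasDerivWithinAt.congr_deriv (h3.congr_of_eventuallyEq ?_ ?_) ?_
  · filter_upwards with t; simp
  · simp
  · simp only [Complex.reCLM_apply]; congr 1; ring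

lemma hasDerivAt_barrier (A x D t : ℝ) :
    HasDerivAt (fun t : ℝ => A * ((t ^ 2 - x ^ 2) ^ 2 / D)) (A * (4 * t * (t ^ 2 - x ^ 2) / D)) t := by
  have h := (((((hasDerivAt_id t).pow 2).sub_const (x ^ 2)).pow 2).div_const D).const_mul A
  refine h.congr_deriv ?_
  simp [-mul_eq_mul_left_iff]; ring

lemma hasDerivAt_barrier_deriv (A x D t : ℝ) :
    HasDerivAt (fun t : ℝ => A * (4 * t * (t ^ 2 - x ^ 2) / D))
      (A * ((12 * t ^ 2 - 4 * x ^ 2) / D)) t := by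
  have h := (((((hasDerivAt_id t).const_mul 4).mul
    (((hasDerivAt_id t).pow 2).sub_const (x ^ 2))).div_const D).const_mul A)
  refine h.congr_deriv ?_
  simp [-mul_eq_mul_left_iff]; ring

/-- Touching from above by a function `φ` at a maximum of `‖u‖ - φ` over a one-sided interval:
the gauge transformed second order part of `L_b` is dominated by `φ''`. -/
lemma gauge_second_deriv_le_of_norm_sub_max {b s e γ : ℝ} {u u' u'' : ℝ → ℂ} {φ φ' : ℝ → ℝ} {θ : ℂ}
    (hs : 0 ≤ s) (hse : s < e)
    (hu : ∀ y ∈ Ici (0 : ℝ), HasDerivWithinAt u (u' y) (Ici 0) y)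
    (hu' : ∀ y ∈ Ici (0 : ℝ), HasDerivWithinAt u' (u'' y) (Ici 0) y)
    (hφ : ∀ t, HasDerivAt φ (φ' t) t) (hφ' : HasDerivAt φ' γ s)
    (hθ : ‖θ‖ = 1) (hθu : θ * u s = ‖u s‖)
    (hmax : ∀ t ∈ Ico s e, ‖u t‖ - φ t ≤ ‖u s‖ - φ s)
    (hcrit : (θ * u' s).re = φ' s) :
    (θ * u'' s).re + (Complex.I * b * (θ * u' s)).re - b ^ 2 / 4 * ‖u s‖ ≤ γ := by
  have hsub : Ici s ⊆ Ici (0 : ℝ) := Ici_subset_Ici.2 hs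
  set w : ℝ → ℂ := fun t => u' t + Complex.I * b / 2 * u t with hw
  have hwd : HasDerivWithinAt w (u'' s + Complex.I * b / 2 * u' s) (Ici s) s :=
    ((hu' s hs).add ((hu s hs).const_mul _)).mono hsub
  have hI : (Complex.I * b / 2 * (‖u s‖ : ℂ)).re = 0 := by
    simp [Complex.mul_re]
  have key := second_deriv_nonpos_of_right_max (s := s) (e := e)
    (g := fun t => (θ * Complex.exp (Complex.I * b / 2 * (t - s)) * u t).re - φ t)
    (g' := fun t => (θ * Complex.exp (Complex.I * b / 2 * (t - s)) * w t).re - φ' t)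
    hse
    (fun t ht => (((hu t (hs.trans ht.1)).mono hsub).gauge b s θ).sub
      (hφ t).hasDerivWithinAt)
    (fun t ht => ?_) ?_ ((hwd.gauge b s θ).sub hφ'.hasDerivWithinAt)
  · have e1 : (θ * Complex.exp (Complex.I * b / 2 * ((s : ℂ) - s)) *
        (u'' s + Complex.I * b / 2 * u' s + Complex.I * b / 2 * w s)) =
        θ * u'' s + Complex.I * b * (θ * u' s) - ((b ^ 2 / 4 * ‖u s‖ : ℝ) : ℂ) := by
      rw [sub_self, mul_zero, Complex.exp_zero]
      push_cast
      rw [← hθu, hw]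
      linear_combination (θ * b ^ 2 / 4 * u s) * Complex.I_sq
    rw [e1] at key
    simp only [Complex.sub_re, Complex.add_re, Complex.ofReal_re] at key
    linarith
  · refine le_trans (sub_le_sub_right ?_ _) ((hmax t ht).trans (sub_le_sub_right (le_of_eq ?_) _))
    · refine (Complex.re_le_norm _).trans (le_of_eq ?_)
      have : Complex.I * b / 2 * ((t : ℂ) - s) = ((b / 2 * (t - s) : ℝ) : ℂ) * Complex.I := by
        push_cast; ring
      rw [norm_mul, norm_mul, hθ, this, Complex.norm_exp_ofReal_mul_I]
      ring
    · simp only [sub_self, mul_zero, Complex.exp_zero, mul_one, hθu, Complex.ofReal_re]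
  · have : θ * Complex.exp (Complex.I * b / 2 * ((s : ℂ) - s)) * w s =
        θ * u' s + Complex.I * b / 2 * (‖u s‖ : ℂ) := by
      rw [sub_self, mul_zero, Complex.exp_zero, ← hθu, hw]
      ring
    simp only [this, Complex.add_re, hI, hcrit]
    ring

/-- At an interior maximum of `‖u‖ - φ` the derivatives match. -/
lemma re_deriv_eq_of_norm_sub_localMax {s d : ℝ} {v : ℂ} {u : ℝ → ℂ} {φ : ℝ → ℝ} {θ : ℂ}
    (hu : HasDerivAt u v s) (hφ : HasDerivAt φ d s)
    (hθ : ‖θ‖ = 1) (hθu : θ * u s = ‖u s‖)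
    (hmax : IsLocalMax (fun t => ‖u t‖ - φ t) s) : (θ * v).re = d := by
  have h1 : HasDerivAt (fun t => (θ * u t).re - φ t) ((θ * v).re - d) s :=
    (Complex.reCLM.hasFDerivAt.comp_hasDerivAt s (hu.const_mul θ)).sub hφ
  have h2 : IsLocalMax (fun t => (θ * u t).re - φ t) s := by
    filter_upwards [hmax] with t ht
    have h3 : (θ * u t).re ≤ ‖u t‖ := by
      refine (Complex.re_le_norm _).trans (le_of_eq ?_)
      rw [norm_mul, hθ, one_mul]
    have h4 : (θ * u s).re = ‖u s‖ := by rw [hθu, Complex.ofReal_re]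
    linarith
  exact sub_eq_zero.1 (h2.hasDerivAt_eq_zero h1)

lemma exists_phase {z : ℂ} (hz : z ≠ 0) : ∃ θ : ℂ, ‖θ‖ = 1 ∧ θ * z = ‖z‖ := by
  have h : (‖z‖ : ℂ) ≠ 0 := by simpa using hz
  refine ⟨‖z‖ / z, ?_, by field_simp⟩
  simp [hz]

lemma abs_sq_sub_sq_le {s x X : ℝ} (hs : 0 ≤ s) (hsX : s ≤ X) (hx : 0 ≤ x) (hxX : x ≤ X) :
    |s ^ 2 - x ^ 2| ≤ X ^ 2 := by
  have := pow_le_pow_left₀ hs hsX 2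
  have := pow_le_pow_left₀ hx hxX 2
  rw [abs_le]
  constructor <;> linarith [sq_nonneg x, sq_nonneg s]

set_option maxHeartbeats 400000 in
/-- Interior estimate of `λ |u|`, by the maximum principle for `|u|`. -/
lemma resolvent_interior_bound {c b l x ρ F M : ℝ} {u u' u'' : ℝ → ℂ} (hc : -1 < c) (hb : |b| = 1)
    (hl : 0 < l) (hx : 0 < x) (hρ : 0 < ρ) (hρ1 : ρ ≤ 1)
    (hu : ∀ y ∈ Ici (0 : ℝ), HasDerivWithinAt u (u' y) (Ici 0) y)
    (hu' : ∀ y ∈ Ici (0 : ℝ), HasDerivWithinAt u' (u'' y) (Ici 0) y)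
    (hcont : ContinuousOn u'' (Ici 0)) (h0 : u' 0 = 0)
    (hF : ∀ t > 0, |t - x| < ρ → ‖(l : ℂ) * u t - Lb c b u u' u'' t‖ ≤ F)
    (hM : ∀ t > 0, |t - x| < ρ → ‖u t‖ ≤ M) :
    l * ‖u x‖ ≤ F + 36 * (12 + 5 * |c|) * (M / ρ ^ 2) := by
  have hxx : |x - x| < ρ := by simpa using hρ
  have hF0 : 0 ≤ F := (norm_nonneg _).trans (hF x hx hxx)
  have hM0 : 0 ≤ M := (norm_nonneg _).trans (hM x hx hxx)
  have hR : 0 ≤ M / ρ ^ 2 := by positivity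
  have hc0 := abs_nonneg c
  rcases eq_or_ne (u x) 0 with hux | hux
  · rw [hux, norm_zero, mul_zero]; positivity
  have hb2 : b ^ 2 = 1 := by rw [← sq_abs, hb]; norm_num
  have hucont : ContinuousOn u (Ici 0) := fun t ht => (hu t ht).continuousWithinAt
  set D : ℝ := (x + ρ) ^ 2 with hD
  have hDpos : 0 < D := by positivity
  set A : ℝ := 36 * M / ρ ^ 2 with hA
  have hA0 : 0 ≤ A := by positivity
  set φ : ℝ → ℝ := fun t => A * ((t ^ 2 - x ^ 2) ^ 2 / D) with hφ
  set a : ℝ := max 0 (x - ρ / 2) with ha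
  have ha0 : 0 ≤ a := le_max_left _ _
  have hax : a ≤ x := max_le hx.le (by linarith)
  have hIsub : Icc a (x + ρ / 2) ⊆ Ici 0 := fun t ht => ha0.trans ht.1
  have hxI : x ∈ Icc a (x + ρ / 2) := ⟨hax, by linarith⟩
  have hGc : ContinuousOn (fun t => ‖u t‖ - φ t) (Icc a (x + ρ / 2)) :=
    (hucont.mono hIsub).norm.sub (by fun_prop)
  obtain ⟨s, hsI, hsmax⟩ := isCompact_Icc.exists_isMaxOn ⟨x, hxI⟩ hGc
  have hs0 : 0 ≤ s := hIsub hsI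
  have hφx : φ x = 0 := by simp [hφ]
  have hxs : ‖u x‖ ≤ ‖u s‖ - φ s := by
    have := hsmax hxI
    simp only [mem_ofPred_eq, hφx, sub_zero] at this
    exact this
  have hφs0 : 0 ≤ φ s := by simp only [hφ]; positivity
  have hus : ‖u x‖ ≤ ‖u s‖ := by linarith
  have hux' : 0 < ‖u x‖ := norm_pos_iff.2 hux
  have hus0 : u s ≠ 0 := norm_pos_iff.1 (hux'.trans_le hus)
  have hm : nhdsWithin (0 : ℝ) (Ioi 0) ≤ nhdsWithin 0 (Ici 0) :=
    nhdsWithin_mono _ Ioi_subset_Ici_self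
  have hMs : ‖u s‖ ≤ M := by
    rcases hs0.eq_or_lt with h | h
    · have hxρ : x - ρ / 2 ≤ 0 := (le_max_right _ _).trans (hsI.1.trans h.symm.le)
      rw [← h]
      have ht : Tendsto (fun t => ‖u t‖) (nhdsWithin 0 (Ioi 0)) (nhds ‖u 0‖) :=
        (Tendsto.mono_left (hucont 0 self_mem_Ici) hm).norm
      refine le_of_tendsto ht ?_
      filter_upwards [Ioo_mem_nhdsGT hx] with t ht
      exact hM t ht.1 (by rw [abs_lt]; constructor <;> linarith [ht.1, ht.2])
    · refine hM s h ?_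
      have := (le_max_right 0 (x - ρ / 2)).trans hsI.1
      rw [abs_lt]; constructor <;> linarith [hsI.2]
  have hφsM : φ s < M := by linarith
  have hMpos : 0 < M := hφs0.trans_lt hφsM
  have hsq : 36 * (s ^ 2 - x ^ 2) ^ 2 < ρ ^ 2 * (x + ρ) ^ 2 := by
    have : φ s = M * (36 * (s ^ 2 - x ^ 2) ^ 2 / (ρ ^ 2 * (x + ρ) ^ 2)) := by
      simp only [hφ, hA, hD]; field_simp
    rw [this] at hφsM
    have h1 : 36 * (s ^ 2 - x ^ 2) ^ 2 / (ρ ^ 2 * (x + ρ) ^ 2) < 1 := by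
      by_contra! h
      nlinarith
    rwa [div_lt_one (by positivity)] at h1
  have hsq' : 6 * |s ^ 2 - x ^ 2| < ρ * (x + ρ) := by
    refine lt_of_pow_lt_pow_left₀ 2 (by positivity) ?_
    rw [mul_pow, mul_pow, sq_abs]; linarith
  obtain ⟨hsq1, hsq2⟩ := abs_lt.1 (by linarith : |s ^ 2 - x ^ 2| < ρ * (x + ρ) / 6)
  have hse : s < x + ρ / 2 := by nlinarith
  obtain ⟨θ, hθ, hθu⟩ := exists_phase hus0
  have hre : ∀ z : ℂ, (θ * z).re ≤ ‖z‖ := fun z =>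
    (Complex.re_le_norm _).trans (le_of_eq (by rw [norm_mul, hθ, one_mul]))
  have hlu : l * ‖u s‖ = (θ * ((l : ℂ) * u s)).re := by
    rw [show θ * ((l : ℂ) * u s) = ((l * ‖u s‖ : ℝ) : ℂ) by
      push_cast; rw [← hθu]; ring, Complex.ofReal_re]
  have hgoal : l * ‖u s‖ ≤ F + (12 + 5 * |c|) * A →
      l * ‖u x‖ ≤ F + 36 * (12 + 5 * |c|) * (M / ρ ^ 2) := fun h => by
    have h1 := mul_le_mul_of_nonneg_left hus hl.le
    refine h1.trans (h.trans (le_of_eq ?_))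
    rw [hA]; ring
  apply hgoal
  have hmaxr : ∀ t ∈ Ico s (x + ρ / 2), ‖u t‖ - φ t ≤ ‖u s‖ - φ s := fun t ht =>
    hsmax ⟨hsI.1.trans ht.1, ht.2.le⟩
  have hMA : M ≤ A := by
    rw [hA, le_div_iff₀ (by positivity)]
    nlinarith [pow_le_one₀ hρ.le hρ1 (n := 2)]
  rcases hs0.eq_or_lt with h | h
  · subst h
    have hkey := gauge_second_deriv_le_of_norm_sub_max (b := b) le_rfl hse hu hu'
      (fun t => hasDerivAt_barrier A x D t) (hasDerivAt_barrier_deriv A x D 0) hθ hθu hmaxr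
      (by simp [h0])
    have hneg : A * ((12 * 0 ^ 2 - 4 * x ^ 2) / D) ≤ 0 := by
      apply mul_nonpos_of_nonneg_of_nonpos hA0
      apply div_nonpos_of_nonpos_of_nonneg _ hDpos.le
      nlinarith
    have hxρ : x - ρ / 2 ≤ 0 := (le_max_right _ _).trans hsI.1
    have ht := ((Tendsto.mono_left (hucont 0 self_mem_Ici) hm).const_mul (l : ℂ)).sub
      (tendsto_Lb_zero (c := c) (b := b) (hu 0 self_mem_Ici) (hu' 0 self_mem_Ici) h0
        (hcont 0 self_mem_Ici))
    have hlim := le_of_tendsto ht.norm (by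
      filter_upwards [Ioo_mem_nhdsGT hx] with t ht
      exact hF t ht.1 (by rw [abs_lt]; constructor <;> linarith [ht.1, ht.2]))
    have h3 := (hre _).trans hlim
    have e : θ * ((l : ℂ) * u 0 - ((1 + c) * u'' 0 - (b : ℂ) ^ 2 / 4 * u 0)) =
        θ * (l * u 0) - ((1 + c : ℝ) : ℂ) * (θ * u'' 0) + ((b ^ 2 / 4 * ‖u 0‖ : ℝ) : ℂ) := by
      push_cast; rw [← hθu]; ring
    rw [e, Complex.add_re, Complex.sub_re, Complex.re_ofReal_mul, Complex.ofReal_re, ← hlu] at h3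
    simp only [h0, mul_zero, Complex.zero_re, hb2, add_zero] at h3 hkey
    have h4 : (1 + c) * (θ * u'' 0).re ≤ (1 + c) * (1 / 4 * ‖u 0‖) :=
      mul_le_mul_of_nonneg_left (by linarith) (by linarith)
    have h5 : c * ‖u 0‖ ≤ |c| * A :=
      mul_le_mul (le_abs_self c) (hMs.trans hMA) (norm_nonneg _) hc0
    have h6 := mul_nonneg hc0 hA0
    linarith
  · have hsa : x - ρ / 2 < s := by
      by_contra! hle
      have hs' : s = x - ρ / 2 := le_antisymm hle ((le_max_right _ _).trans hsI.1)
      have := mul_pos hρ h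
      rw [hs'] at this hsq1
      linarith
    have hloc : IsLocalMax (fun t => ‖u t‖ - φ t) s := by
      filter_upwards [Icc_mem_nhds (max_lt h hsa) hse] with t ht using hsmax ht
    have hcrit := re_deriv_eq_of_norm_sub_localMax
      ((hu s hs0).hasDerivAt (Ici_mem_nhds h)) (hasDerivAt_barrier A x D s) hθ hθu hloc
    have hkey := gauge_second_deriv_le_of_norm_sub_max (b := b) hs0 hse hu hu'
      (fun t => hasDerivAt_barrier A x D t) (hasDerivAt_barrier_deriv A x D s) hθ hθu hmaxr hcrit
    have h3 := (hre _).trans (hF s h (by rw [abs_lt]; constructor <;> linarith))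
    have e : θ * ((l : ℂ) * u s - Lb c b u u' u'' s) =
        θ * (l * u s) - θ * u'' s - ((c / s : ℝ) : ℂ) * (θ * u' s)
          - Complex.I * b * (θ * u' s) + ((b ^ 2 / 4 * ‖u s‖ : ℝ) : ℂ) := by
      simp only [Lb]
      push_cast; rw [← hθu]; ring
    rw [e, Complex.add_re, Complex.sub_re, Complex.sub_re, Complex.sub_re, Complex.re_ofReal_mul,
      Complex.ofReal_re, ← hlu, hcrit] at h3
    have e2 : c / s * (A * (4 * s * (s ^ 2 - x ^ 2) / D)) = A * (4 * c * ((s ^ 2 - x ^ 2) / D)) := by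
      field_simp
    rw [e2] at h3
    have hsD : (12 * s ^ 2 - 4 * x ^ 2) / D ≤ 12 := by
      rw [div_le_iff₀ hDpos, hD]
      have := pow_le_pow_left₀ hs0 (show s ≤ x + ρ by linarith only [hse, hρ]) 2
      linarith only [this, sq_nonneg x]
    have hcD : c * ((s ^ 2 - x ^ 2) / D) ≤ |c| := by
      refine (le_abs_self _).trans ?_
      rw [abs_mul]
      refine mul_le_of_le_one_right hc0 ?_
      rw [abs_div, abs_of_pos hDpos, div_le_one hDpos]
      exact abs_sq_sub_sq_le hs0 (by linarith only [hse, hρ]) hx.le (by linarith only [hρ])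
    have h4 := mul_le_mul_of_nonneg_left hsD hA0
    have h5 := mul_le_mul_of_nonneg_left hcD hA0
    have h6 := mul_nonneg hA0 hc0
    linarith only [h3, hkey, h4, h5, h6]

/-- Gradient bound near the singular point, from `(t^c e^{ibt} u')' = t^c e^{ibt} g`. -/
lemma norm_deriv_le_of_near_zero {c b z Γ : ℝ} {u' u'' : ℝ → ℂ} (hc : -1 < c) (hz : 0 < z)
    (hu' : ∀ y ∈ Ici (0 : ℝ), HasDerivWithinAt u' (u'' y) (Ici 0) y) (h0 : u' 0 = 0)
    (hΓ : ∀ t ∈ Ioc 0 z, ‖u'' t + ((c : ℂ) / t + Complex.I * b) * u' t‖ ≤ Γ) :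
    ‖u' z‖ ≤ z * Γ / (1 + c) := by
  have hc1 : 0 < c + 1 := by linarith
  set f : ℝ → ℂ := fun t => ((t ^ c : ℝ) : ℂ) * Complex.exp (((b * t : ℝ) : ℂ) * Complex.I) * u' t
    with hf
  have hfnorm : ∀ t > 0, ‖f t‖ = t ^ c * ‖u' t‖ := fun t ht => by
    simp only [hf, norm_mul, Complex.norm_exp_ofReal_mul_I, Complex.norm_real, Real.norm_eq_abs,
      abs_of_pos (Real.rpow_pos_of_pos ht c), mul_one]
  have hfd : ∀ t > 0, HasDerivAt f (((t ^ c : ℝ) : ℂ) *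
      Complex.exp (((b * t : ℝ) : ℂ) * Complex.I) *
        (u'' t + ((c : ℂ) / t + Complex.I * b) * u' t)) t := fun t ht => by
    have h1 : HasDerivAt (fun t : ℝ => ((t ^ c : ℝ) : ℂ)) ((c * t ^ (c - 1) : ℝ) : ℂ) t :=
      (Real.hasDerivAt_rpow_const (Or.inl ht.ne')).ofReal_comp
    have h2 : HasDerivAt (fun t : ℝ => ((b * t : ℝ) : ℂ) * Complex.I) (b * Complex.I) t := by
      have := (((hasDerivAt_id t).const_mul b).ofReal_comp).mul_const Complex.I
      simpa using this
    refine ((h1.mul h2.cexp).mul ((hu' t ht.le).hasDerivAt (Ici_mem_nhds ht))).congr_deriv ?_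
    have ht' : (t : ℂ) ≠ 0 := by exact_mod_cast ht.ne'
    simp only [Pi.mul_apply]
    rw [Real.rpow_sub_one ht.ne']
    push_cast
    field_simp
    ring
  have hest : ∀ ε ∈ Ioo 0 z, z ^ c * ‖u' z‖ ≤ ε ^ c * ‖u' ε‖ + Γ * (z ^ (c + 1) / (c + 1)) := by
    intro ε hε
    have hΓ0 : 0 ≤ Γ := (norm_nonneg _).trans (hΓ z ⟨hz, le_rfl⟩)
    have hBd : ∀ t > 0, HasDerivAt (fun t : ℝ => ‖f ε‖ + Γ * (t ^ (c + 1) / (c + 1)))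
        (Γ * t ^ c) t := fun t ht => by
      refine ((((Real.hasDerivAt_rpow_const (p := c + 1) (Or.inl ht.ne')).div_const
        (c + 1)).const_mul Γ).const_add ‖f ε‖).congr_deriv ?_
      rw [add_sub_cancel_right]
      field_simp
    have := image_norm_le_of_norm_deriv_right_le_deriv_boundary' (a := ε) (b := z) (f := f)
      (fun t ht => (hfd t (hε.1.trans_le ht.1)).continuousAt.continuousWithinAt)
      (fun t ht => (hfd t (hε.1.trans_le ht.1)).hasDerivWithinAt)
      (B := fun t => ‖f ε‖ + Γ * (t ^ (c + 1) / (c + 1)))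
      (le_add_of_nonneg_right (by have := hε.1; positivity))
      (fun t ht => (hBd t (hε.1.trans_le ht.1)).continuousAt.continuousWithinAt)
      (fun t ht => (hBd t (hε.1.trans_le ht.1)).hasDerivWithinAt)
      (fun t ht => ?_) ⟨hε.2.le, le_rfl⟩
    · rwa [hfnorm z hz, hfnorm ε hε.1] at this
    · have htp : 0 < t := hε.1.trans_le ht.1
      rw [norm_mul, norm_mul, Complex.norm_exp_ofReal_mul_I, Complex.norm_real, Real.norm_eq_abs,
        abs_of_pos (Real.rpow_pos_of_pos htp c), mul_one, mul_comm]
      exact mul_le_mul_of_nonneg_right (hΓ t ⟨htp, ht.2.le⟩) (Real.rpow_pos_of_pos htp c).le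
  have hlim : Tendsto (fun ε : ℝ => ε ^ c * ‖u' ε‖ + Γ * (z ^ (c + 1) / (c + 1)))
      (nhdsWithin 0 (Ioi 0)) (nhds (0 + Γ * (z ^ (c + 1) / (c + 1)))) := by
    refine Tendsto.add_const _ ?_
    have h1 := (tendsto_div_self_of_hasDerivWithinAt_zero h0 (hu' 0 self_mem_Ici)).norm
    have h2 : Tendsto (fun ε : ℝ => ε ^ (c + 1)) (nhdsWithin 0 (Ioi 0)) (nhds 0) := by
      have := (Real.continuousAt_rpow_const 0 (c + 1) (Or.inr hc1.le)).tendsto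
      rw [Real.zero_rpow hc1.ne'] at this
      exact this.mono_left nhdsWithin_le_nhds
    have h3 := h2.mul h1
    rw [zero_mul] at h3
    refine h3.congr' ?_
    filter_upwards [self_mem_nhdsWithin] with t ht
    have ht' : 0 < t := ht
    rw [norm_div, Complex.norm_real, Real.norm_eq_abs, abs_of_pos ht', Real.rpow_add_one ht'.ne']
    field_simp
  have hfin := ge_of_tendsto hlim (by
    filter_upwards [Ioo_mem_nhdsGT hz] with ε hε using hest ε hε)
  rw [zero_add, Real.rpow_add_one hz.ne'] at hfin
  have hzc := Real.rpow_pos_of_pos hz c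
  refine le_of_mul_le_mul_left (hfin.trans (le_of_eq ?_)) hzc
  rw [add_comm 1 c]
  ring

/-- Landau type inequality on an interval where the first order coefficient is bounded. -/
lemma norm_deriv_le_of_bounded_coeff {z d k U Γ : ℝ} {u u' u'' κ : ℝ → ℂ} (hd : 0 < d)
    (hk : 0 ≤ k) (hkd : k * d ≤ 1 / 2)
    (hu : ∀ t ∈ Icc z (z + d), HasDerivWithinAt u (u' t) (Icc z (z + d)) t)
    (hu' : ∀ t ∈ Icc z (z + d), HasDerivWithinAt u' (u'' t) (Icc z (z + d)) t)
    (hκ : ∀ t ∈ Icc z (z + d), ‖κ t‖ ≤ k)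
    (hU : ∀ t ∈ Icc z (z + d), ‖u t‖ ≤ U)
    (hΓ : ∀ t ∈ Icc z (z + d), ‖u'' t + κ t * u' t‖ ≤ Γ) :
    ‖u' z‖ ≤ 4 * U / d + 2 * d * Γ := by
  have hzI : z ∈ Icc z (z + d) := ⟨le_rfl, by linarith⟩
  have hzdI : z + d ∈ Icc z (z + d) := ⟨by linarith, le_rfl⟩
  have hc : ContinuousOn (fun t => ‖u' t‖) (Icc z (z + d)) :=
    ContinuousOn.norm fun t ht => (hu' t ht).continuousWithinAt
  obtain ⟨s, hs, hmax⟩ := isCompact_Icc.exists_isMaxOn ⟨z, hzI⟩ hc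
  set N := ‖u' s‖ with hN
  have hN0 : 0 ≤ N := norm_nonneg _
  have hmax' : ∀ t ∈ Icc z (z + d), ‖u' t‖ ≤ N := fun t ht => hmax ht
  have hu2 : ∀ t ∈ Icc z (z + d), ‖u'' t‖ ≤ Γ + k * N := fun t ht => by
    have h1 : u'' t = (u'' t + κ t * u' t) - κ t * u' t := by ring
    rw [h1]
    refine (norm_sub_le _ _).trans (add_le_add (hΓ t ht) ?_)
    rw [norm_mul]
    exact mul_le_mul (hκ t ht) (hmax' t ht) (norm_nonneg _) hk
  have hB0 : 0 ≤ Γ + k * N := (norm_nonneg _).trans (hu2 z hzI)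
  have hosc : ∀ t ∈ Icc z (z + d), ‖u' t - u' s‖ ≤ (Γ + k * N) * d := fun t ht => by
    refine ((convex_Icc z (z + d)).norm_image_sub_le_of_norm_hasDerivWithin_le hu' hu2 hs
      ht).trans (mul_le_mul_of_nonneg_left ?_ hB0)
    rw [Real.norm_eq_abs, abs_le]
    constructor <;> linarith [hs.1, hs.2, ht.1, ht.2]
  have hmv := (convex_Icc z (z + d)).norm_image_sub_le_of_norm_hasDerivWithin_le
    (f := fun t => u t - (t : ℂ) * u' s) (f' := fun t => u' t - u' s) (fun t ht =>
      ((hu t ht).sub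
        ((Complex.ofRealCLM.hasDerivAt (x := t)).mul_const (u' s)).hasDerivWithinAt).congr_deriv
          (by simp)) hosc hzI hzdI
  rw [add_sub_cancel_left, Real.norm_eq_abs, abs_of_pos hd] at hmv
  have h2 : d * N ≤ ‖u (z + d)‖ + ‖u z‖ + (Γ + k * N) * d * d := by
    have e : (d : ℂ) * u' s = u (z + d) - u z -
        (u (z + d) - ((z + d : ℝ) : ℂ) * u' s - (u z - (z : ℂ) * u' s)) := by
      push_cast; ring
    have e2 : d * N = ‖(d : ℂ) * u' s‖ := by
      rw [norm_mul, Complex.norm_real, Real.norm_eq_abs, abs_of_pos hd]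
    rw [e2, e]
    exact (norm_sub_le _ _).trans (add_le_add (norm_sub_le _ _) hmv)
  have h3 : k * d * (d * N) ≤ 1 / 2 * (d * N) :=
    mul_le_mul_of_nonneg_right hkd (by positivity)
  have h4 : N * d ≤ (4 * U / d + 2 * d * Γ) * d := by
    have : (4 * U / d + 2 * d * Γ) * d = 4 * U + 2 * d * d * Γ := by field_simp
    rw [this]
    linarith [hU _ hzI, hU _ hzdI]
  exact (hmax' z hzI).trans (le_of_mul_le_mul_right h4 hd)

/-- Interior gradient estimate at scale `δ ≤ 1`. -/
lemma interior_gradient_bound {c b z δ U Γ : ℝ} {u u' u'' : ℝ → ℂ} (hc : -1 < c) (hb : |b| = 1)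
    (hz : 0 < z) (hδ : 0 < δ) (hδ1 : δ ≤ 1)
    (hu : ∀ y ∈ Ici (0 : ℝ), HasDerivWithinAt u (u' y) (Ici 0) y)
    (hu' : ∀ y ∈ Ici (0 : ℝ), HasDerivWithinAt u' (u'' y) (Ici 0) y) (h0 : u' 0 = 0)
    (hU : ∀ t > 0, |t - z| < 2 * δ → ‖u t‖ ≤ U)
    (hΓ : ∀ t > 0, |t - z| < 2 * δ → ‖u'' t + ((c : ℂ) / t + Complex.I * b) * u' t‖ ≤ Γ) :
    ‖u' z‖ ≤ (8 * (|c| + 1) + 1 / (1 + c)) * (U / δ + δ * Γ) := by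
  have hzz : |z - z| < 2 * δ := by rw [sub_self, abs_zero]; linarith
  have hU0 : 0 ≤ U := (norm_nonneg _).trans (hU z hz hzz)
  have hΓ0 : 0 ≤ Γ := (norm_nonneg _).trans (hΓ z hz hzz)
  have hc1 : 0 < 1 + c := by linarith
  have hc0 := abs_nonneg c
  have hUd : 0 ≤ U / δ := by positivity
  have hdΓ : 0 ≤ δ * Γ := by positivity
  have hi : 0 ≤ 1 / (1 + c) := by positivity
  rcases le_total z δ with h | h
  · have := norm_deriv_le_of_near_zero hc hz hu' h0 (b := b) (Γ := Γ) fun t ht =>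
      hΓ t ht.1 (by rw [abs_lt]; constructor <;> linarith [ht.1, ht.2])
    calc ‖u' z‖ ≤ z * Γ / (1 + c) := this
      _ ≤ δ * Γ / (1 + c) := by gcongr
      _ = 1 / (1 + c) * (δ * Γ) := by ring
      _ ≤ _ := mul_le_mul (by linarith) (by linarith) hdΓ (by positivity)
  · set d := δ / (2 * (|c| + 1)) with hd
    have hd0 : 0 < d := by positivity
    have hdδ : d ≤ δ := div_le_self hδ.le (by linarith)
    have hsub : Icc z (z + d) ⊆ Ici 0 := fun t ht => hz.le.trans ht.1
    have hpos : ∀ t ∈ Icc z (z + d), 0 < t := fun t ht => hz.trans_le ht.1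
    have hab : ∀ t ∈ Icc z (z + d), |t - z| < 2 * δ := fun t ht => by
      rw [abs_lt]; constructor <;> linarith [ht.1, ht.2]
    have key := norm_deriv_le_of_bounded_coeff (k := (|c| + 1) / δ) hd0 (by positivity)
      (le_of_eq (by rw [hd]; field_simp))
      (fun t ht => (hu t (hsub ht)).mono hsub) (fun t ht => (hu' t (hsub ht)).mono hsub)
      (fun t ht => ?_) (fun t ht => hU t (hpos t ht) (hab t ht))
      (fun t ht => hΓ t (hpos t ht) (hab t ht))
    · have e1 : 4 * U / d = 8 * (|c| + 1) * (U / δ) := by rw [hd]; field_simp; ring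
      have e2 : 2 * d * Γ ≤ 2 * (δ * Γ) := by nlinarith
      rw [e1] at key
      nlinarith [mul_nonneg hc0 hdΓ, mul_nonneg hi hdΓ, mul_nonneg hi hUd]
    · refine (norm_add_le _ _).trans ?_
      have htδ : δ ≤ t := h.trans ht.1
      rw [norm_div, norm_mul, Complex.norm_I, Complex.norm_real, Complex.norm_real,
        Complex.norm_real, Real.norm_eq_abs, Real.norm_eq_abs, Real.norm_eq_abs, hb,
        abs_of_pos (hpos t ht), add_div, one_mul]
      exact add_le_add (div_le_div_of_nonneg_left hc0 hδ htδ) ((one_le_div hδ).2 hδ1)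

/-- The pointwise form of the local gradient estimate. -/
lemma sqrt_mul_norm_deriv_le {c b l z ρ F M : ℝ} {u u' u'' : ℝ → ℂ} (hc : -1 < c) (hb : |b| = 1)
    (hl : 0 < l) (hz : 0 < z) (hρ : 0 < ρ) (hρ1 : ρ ≤ 1)
    (hu : ∀ y ∈ Ici (0 : ℝ), HasDerivWithinAt u (u' y) (Ici 0) y)
    (hu' : ∀ y ∈ Ici (0 : ℝ), HasDerivWithinAt u' (u'' y) (Ici 0) y)
    (hcont : ContinuousOn u'' (Ici 0)) (h0 : u' 0 = 0)
    (hF : ∀ t > 0, |t - z| < ρ → ‖(l : ℂ) * u t - Lb c b u u' u'' t‖ ≤ F)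
    (hM : ∀ t > 0, |t - z| < ρ → ‖u t‖ ≤ M) :
    √l * ‖u' z‖ ≤ (8 * (|c| + 1) + 1 / (1 + c)) * (4 * (1 + 144 * (12 + 5 * |c|)) + 4) *
      (F + M / ρ ^ 2) := by
  have hzz : |z - z| < ρ := by simpa using hρ
  have hF0 : 0 ≤ F := (norm_nonneg _).trans (hF z hz hzz)
  have hM0 : 0 ≤ M := (norm_nonneg _).trans (hM z hz hzz)
  have hR : 0 ≤ M / ρ ^ 2 := by positivity
  have hMR : M ≤ M / ρ ^ 2 := le_div_self hM0 (by positivity) (pow_le_one₀ hρ.le hρ1)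
  have hc0 := abs_nonneg c
  have hc1 : 0 < 1 + c := by linarith
  set K := F + M / ρ ^ 2 with hK
  have hK0 : 0 ≤ K := by positivity
  set C₂ := 1 + 144 * (12 + 5 * |c|) with hC₂
  have hC₂0 : 0 ≤ C₂ := by positivity
  have hlu : ∀ t > 0, |t - z| < ρ / 2 → l * ‖u t‖ ≤ C₂ * K := fun t ht htz => by
    have hin : ∀ s, |s - t| < ρ / 2 → |s - z| < ρ := fun s hs => by
      have := abs_sub_le s t z
      linarith
    refine (resolvent_interior_bound hc hb hl ht (half_pos hρ) (by linarith) hu hu' hcont h0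
      (fun s hs hst => hF s hs (hin s hst)) (fun s hs hst => hM s hs (hin s hst))).trans ?_
    have e : M / (ρ / 2) ^ 2 = 4 * (M / ρ ^ 2) := by field_simp; ring
    rw [e, hK, hC₂]
    nlinarith [mul_nonneg hc0 hF0]
  have hsl : 0 < √l := Real.sqrt_pos.2 hl
  have hsq : √l * √l = l := Real.mul_self_sqrt hl.le
  set δ := min (ρ / 4) (1 / √l) with hδ
  have hδ0 : 0 < δ := lt_min (by positivity) (by positivity)
  have hδρ : δ ≤ ρ / 4 := min_le_left _ _
  have hδl : √l * δ ≤ 1 := by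
    have := mul_le_mul_of_nonneg_left (min_le_right (ρ / 4) (1 / √l)) hsl.le
    rwa [mul_one_div_cancel hsl.ne'] at this
  have hδinv : 1 / δ ≤ 4 / ρ + √l := by
    rw [hδ]
    rcases min_cases (ρ / 4) (1 / √l) with ⟨h, -⟩ | ⟨h, -⟩ <;> rw [h]
    · rw [one_div_div]; linarith
    · rw [one_div_one_div]
      have : 0 < 4 / ρ := by positivity
      linarith
  set U := min M (C₂ * K / l) with hU
  have hU0 : 0 ≤ U := le_min hM0 (by positivity)
  have hUM : U / ρ ^ 2 ≤ K := by
    have : U / ρ ^ 2 ≤ M / ρ ^ 2 := by gcongr; exact min_le_left _ _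
    linarith
  have hUl : l * U ≤ C₂ * K := by
    have := min_le_right M (C₂ * K / l)
    rw [le_div_iff₀ hl] at this
    linarith
  have hgrad := interior_gradient_bound (U := U) (Γ := (C₂ + 2) * K) hc hb hz hδ0 (by linarith)
    hu hu' h0 (fun t ht htz => ?_) (fun t ht htz => ?_)
  · have h1 : √l * (U / δ) ≤ (3 * C₂ + 2) * K := by
      have e1 : √l * (U / δ) ≤ √l * (U * (4 / ρ + √l)) := by
        rw [div_eq_mul_one_div U δ]
        gcongr
      have e2 : √l * (U * (4 / ρ + √l)) = l * U + 4 * (√l * (1 / ρ)) * U := by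
        linear_combination U * hsq
      have e3 : 2 * (√l * (1 / ρ)) ≤ l + 1 / ρ ^ 2 := by
        have := sq_nonneg (√l - 1 / ρ)
        have e : (√l - 1 / ρ) ^ 2 = √l * √l + 1 / ρ ^ 2 - 2 * (√l * (1 / ρ)) := by
          field_simp; ring
        rw [e, hsq] at this
        linarith
      have e4 := mul_le_mul_of_nonneg_right e3 hU0
      have e5 : (l + 1 / ρ ^ 2) * U = l * U + U / ρ ^ 2 := by ring
      linarith
    have h2 : √l * (δ * ((C₂ + 2) * K)) ≤ (C₂ + 2) * K := by
      rw [← mul_assoc]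
      exact mul_le_of_le_one_left (by positivity) hδl
    have hC : 0 ≤ 8 * (|c| + 1) + 1 / (1 + c) := by positivity
    calc √l * ‖u' z‖
        ≤ √l * ((8 * (|c| + 1) + 1 / (1 + c)) * (U / δ + δ * ((C₂ + 2) * K))) := by gcongr
      _ = (8 * (|c| + 1) + 1 / (1 + c)) * (√l * (U / δ) + √l * (δ * ((C₂ + 2) * K))) := by ring
      _ ≤ (8 * (|c| + 1) + 1 / (1 + c)) * ((3 * C₂ + 2) * K + (C₂ + 2) * K) := by gcongr
      _ = _ := by ring
  · refine le_min (hM t ht (by linarith)) ?_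
    rw [le_div_iff₀ hl, mul_comm]
    exact hlu t ht (by linarith)
  · have e : u'' t + ((c : ℂ) / t + Complex.I * b) * u' t =
        (l : ℂ) * u t - ((l : ℂ) * u t - Lb c b u u' u'' t) + (b : ℂ) ^ 2 / 4 * u t := by
      simp only [Lb]; ring
    rw [e]
    have n1 : ‖(l : ℂ) * u t‖ ≤ C₂ * K := by
      rw [norm_mul, Complex.norm_real, Real.norm_eq_abs, abs_of_pos hl]
      exact hlu t ht (by linarith)
    have n2 : ‖(b : ℂ) ^ 2 / 4 * u t‖ ≤ M := by
      rw [norm_mul, norm_div, norm_pow, Complex.norm_real, Real.norm_eq_abs, hb]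
      have := hM t ht (by linarith)
      norm_num
      linarith [norm_nonneg (u t)]
    have n3 := hF t ht (by linarith)
    refine (norm_add_le _ _).trans ?_
    have := norm_sub_le ((l : ℂ) * u t) ((l : ℂ) * u t - Lb c b u u' u'' t)
    have : F ≤ K := by linarith
    linarith

lemma le_supOn_of_bound {f : ℝ → ℂ} {s : Set ℝ} {B t : ℝ} (h : ∀ x ∈ s, ‖f x‖ ≤ B) (ht : t ∈ s) :
    ‖f t‖ ≤ supOn f s :=
  le_ciSup (f := fun z : s => ‖f z.1‖) ⟨B, by rintro _ ⟨z, rfl⟩; exact h z.1 z.2⟩ ⟨t, ht⟩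

/-- `λ u - L_b u` is bounded on bounded intervals, also near `0`. -/
lemma exists_bound_resolvent {c b l R : ℝ} {u u' u'' : ℝ → ℂ} (hR : 0 < R)
    (hu : ∀ y ∈ Ici (0 : ℝ), HasDerivWithinAt u (u' y) (Ici 0) y)
    (hu' : ∀ y ∈ Ici (0 : ℝ), HasDerivWithinAt u' (u'' y) (Ici 0) y)
    (hcont : ContinuousOn u'' (Ici 0)) (h0 : u' 0 = 0) :
    ∃ B, ∀ t ∈ Ioc 0 R, ‖(l : ℂ) * u t - Lb c b u u' u'' t‖ ≤ B := by
  have hsub : Icc 0 R ⊆ Ici 0 := Icc_subset_Ici_self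
  have hcu : ContinuousOn u (Icc 0 R) := fun t ht => (hu t (hsub ht)).continuousWithinAt.mono hsub
  have hcu' : ContinuousOn u' (Icc 0 R) :=
    fun t ht => (hu' t (hsub ht)).continuousWithinAt.mono hsub
  obtain ⟨N, hN⟩ := isCompact_Icc.exists_bound_of_continuousOn (hcont.mono hsub)
  obtain ⟨B, hB⟩ := isCompact_Icc.exists_bound_of_continuousOn
    (f := fun t => (l : ℂ) * u t - u'' t - Complex.I * b * u' t + (b : ℂ) ^ 2 / 4 * u t)
    ((((hcu.const_mul _).sub (hcont.mono hsub)).sub (hcu'.const_mul _)).add (hcu.const_mul _))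
  refine ⟨B + |c| * N, fun t ht => ?_⟩
  have htI : t ∈ Icc 0 R := Ioc_subset_Icc_self ht
  have hmv := (convex_Icc 0 R).norm_image_sub_le_of_norm_hasDerivWithin_le
    (fun s hs => (hu' s (hsub hs)).mono hsub) hN ⟨le_rfl, hR.le⟩ htI
  rw [h0, sub_zero, sub_zero, Real.norm_eq_abs, abs_of_pos ht.1] at hmv
  have e : (l : ℂ) * u t - Lb c b u u' u'' t =
      ((l : ℂ) * u t - u'' t - Complex.I * b * u' t + (b : ℂ) ^ 2 / 4 * u t) -
        (c : ℂ) / t * u' t := by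
    simp only [Lb]; ring
  rw [e]
  refine (norm_sub_le _ _).trans (add_le_add (hB t htI) ?_)
  rw [norm_mul, norm_div, Complex.norm_real, Complex.norm_real, Real.norm_eq_abs,
    Real.norm_eq_abs, abs_of_pos ht.1, div_mul_eq_mul_div, div_le_iff₀ ht.1, mul_assoc]
  exact mul_le_mul_of_nonneg_left hmv (abs_nonneg c)

/-- for `c > -1` there is `C > 0`, depending only on `c`, such that for
every `b` with `|b| = 1`, every `u ∈ Ĉ²_𝒩`, `λ > 0`, `y > 0` and `r > 0`:
`λ^{1/2} ‖u'‖_{L^∞(B⁺(y,r))}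
  ≤ C (‖λu − L_b u‖_{L^∞(B⁺(y,2r))} + (1/r² + 1)‖u‖_{L^∞(B⁺(y,2r))})`. -/
theorem statement_9 (c : ℝ) (hc : -1 < c) :
    ∃ C : ℝ, 0 < C ∧
      ∀ b : ℝ, |b| = 1 →
      ∀ u u' u'' : ℝ → ℂ, MemC2N u u' u'' →
      ∀ l : ℝ, 0 < l → ∀ y : ℝ, 0 < y → ∀ r : ℝ, 0 < r →
        Real.sqrt l * supOn u' (Bplus y r)
          ≤ C * (supOn (fun z => (l : ℂ) * u z - Lb c b u u' u'' z) (Bplus y (2 * r))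
              + (1 / r ^ 2 + 1) * supOn u (Bplus y (2 * r))) := by
  have hc0 := abs_nonneg c
  have hc1 : 0 < 1 + c := by linarith
  set C : ℝ := (8 * (|c| + 1) + 1 / (1 + c)) * (4 * (1 + 144 * (12 + 5 * |c|)) + 4) with hC
  have hCpos : 0 < C := by positivity
  refine ⟨C, hCpos, ?_⟩
  rintro b hb u u' u'' ⟨hu, hu', -, -, huc'', -, -, -, h0⟩ l hl y hy r hr
  have hsl : 0 < √l := Real.sqrt_pos.2 hl
  have hsubI : Bplus y (2 * r) ⊆ Ioc 0 (y + 2 * r) := fun t ht => ⟨ht.2, ht.1.2.le⟩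
  have hR : 0 < y + 2 * r := by positivity
  obtain ⟨B₁, hB₁⟩ := exists_bound_resolvent (c := c) (b := b) (l := l) hR hu hu'
    huc''.continuousOn h0
  obtain ⟨B₂, hB₂⟩ := isCompact_Icc.exists_bound_of_continuousOn (f := u) (s := Icc 0 (y + 2 * r))
    fun t ht => (hu t ht.1).continuousWithinAt.mono Icc_subset_Ici_self
  have hF : ∀ t ∈ Bplus y (2 * r), ‖(l : ℂ) * u t - Lb c b u u' u'' t‖ ≤
      supOn (fun z => (l : ℂ) * u z - Lb c b u u' u'' z) (Bplus y (2 * r)) := fun t ht =>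
    le_supOn_of_bound (f := fun z => (l : ℂ) * u z - Lb c b u u' u'' z)
      (fun x hx => hB₁ x (hsubI hx)) ht
  have hM : ∀ t ∈ Bplus y (2 * r), ‖u t‖ ≤ supOn u (Bplus y (2 * r)) := fun t ht =>
    le_supOn_of_bound (fun x hx => hB₂ x (Ioc_subset_Icc_self (hsubI hx))) ht
  set F := supOn (fun z => (l : ℂ) * u z - Lb c b u u' u'' z) (Bplus y (2 * r))
  set M := supOn u (Bplus y (2 * r))
  have hyI : y ∈ Bplus y r := ⟨⟨by linarith, by linarith⟩, hy⟩
  have hM0 : 0 ≤ M := (norm_nonneg _).trans (hM y ⟨⟨by linarith, by linarith⟩, hy⟩)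
  have : Nonempty (Bplus y r) := ⟨⟨y, hyI⟩⟩
  rw [← le_div_iff₀' hsl]
  refine ciSup_le fun ⟨z, hz⟩ => ?_
  rw [le_div_iff₀' hsl]
  have hzp : 0 < z := hz.2
  have hρ : 0 < min r 1 := lt_min hr one_pos
  have hin : ∀ t > 0, |t - z| < min r 1 → t ∈ Bplus y (2 * r) := fun t ht htz => by
    obtain ⟨h1, h2⟩ := abs_lt.1 (htz.trans_le (min_le_left _ _))
    have h3 := hz.1.1
    have h4 := hz.1.2
    exact ⟨⟨by linarith, by linarith⟩, ht⟩
  refine (sqrt_mul_norm_deriv_le hc hb hl hzp hρ (min_le_right _ _) hu hu' huc''.continuousOn h0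
    (fun t ht htz => hF t (hin t ht htz)) (fun t ht htz => hM t (hin t ht htz))).trans ?_
  refine mul_le_mul_of_nonneg_left (add_le_add le_rfl ?_) hCpos.le
  rw [div_eq_mul_one_div, mul_comm]
  refine mul_le_mul_of_nonneg_right ?_ hM0
  have hr2 : 0 < 1 / r ^ 2 := by positivity
  rcases min_cases r 1 with ⟨h, -⟩ | ⟨h, -⟩ <;> rw [h]
  · linarith
  · norm_num
    positivity
end
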